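/- Let n be a natural number whose binary representation contains exactly six 1s. Then the binary representation of the triangular number t_n = n(n+1)/2 contains at least four 1s. -/

import Mathlib

/-- The n-th triangular number. -/
def triangular (n : ℕ) : ℕ := n * (n + 1) / 2

/-- A natural number is triangular if it is `triangular n` for some `n`. -/
def IsTriangular (m : ℕ) : Prop := ∃ n : ℕ, triangular n = m

/-- The number of 1s in the binary representation of `m` (binary digit sum). -/
def binOnes (m : ℕ) : ℕ := (Nat.digits 2 m).sum

/-- A number is very triangular if it is triangular and its binary digit sum is triangular. -/
def IsVeryTriangular (m : ℕ) : Prop := IsTriangular m ∧ IsTriangular (binOnes m)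

/-! ### Binary digit sums -/

theorem binOnes_zero : binOnes 0 = 0 := by simp [binOnes]

theorem binOnes_two_mul (n : ℕ) : binOnes (2 * n) = binOnes n := by
  rcases Nat.eq_zero_or_pos n with rfl | h
  · rfl
  · simp [binOnes, Nat.digits_def' one_lt_two (show 0 < 2 * n by omega)]

theorem binOnes_two_mul_add_one (n : ℕ) : binOnes (2 * n + 1) = binOnes n + 1 := by
  rw [binOnes, binOnes, Nat.digits_def' one_lt_two (show 0 < 2 * n + 1 by omega), List.sum_cons,
    show (2 * n + 1) % 2 = 1 by omega, show (2 * n + 1) / 2 = n by omega, add_comm]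

theorem binOnes_one : binOnes 1 = 1 := by
  simpa [binOnes_zero] using binOnes_two_mul_add_one 0

theorem binOnes_two_pow_mul (k n : ℕ) : binOnes (2 ^ k * n) = binOnes n := by
  induction k with
  | zero => simp
  | succ k ih => rw [pow_succ', mul_assoc, binOnes_two_mul, ih]

theorem binOnes_two_pow (k : ℕ) : binOnes (2 ^ k) = 1 := by
  simpa [binOnes_one] using binOnes_two_pow_mul k 1

theorem binOnes_add_two_pow_mul {k a : ℕ} (b : ℕ) (h : a < 2 ^ k) :
    binOnes (a + 2 ^ k * b) = binOnes a + binOnes b := by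
  induction k generalizing a with
  | zero =>
    obtain rfl : a = 0 := by simpa using h
    simp [binOnes_zero]
  | succ k ih =>
    rw [pow_succ'] at h ⊢
    obtain ⟨d, rfl | rfl⟩ := Nat.even_or_odd' a
    · rw [show 2 * d + 2 * 2 ^ k * b = 2 * (d + 2 ^ k * b) by ring, binOnes_two_mul,
        binOnes_two_mul, ih (by omega)]
    · rw [show 2 * d + 1 + 2 * 2 ^ k * b = 2 * (d + 2 ^ k * b) + 1 by ring,
        binOnes_two_mul_add_one, binOnes_two_mul_add_one, ih (by omega)]
      ring

theorem binOnes_pos {n : ℕ} (h : 0 < n) : 0 < binOnes n := by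
  induction n using Nat.strong_induction_on with
  | _ n ih =>
    obtain ⟨d, rfl | rfl⟩ := Nat.even_or_odd' n
    · rw [binOnes_two_mul]
      exact ih d (by omega) (by omega)
    · rw [binOnes_two_mul_add_one]
      omega

theorem exists_eq_two_pow_of_binOnes_eq_one {n : ℕ} (h : binOnes n = 1) : ∃ k, n = 2 ^ k := by
  induction n using Nat.strong_induction_on with
  | _ n ih =>
    obtain ⟨d, rfl | rfl⟩ := Nat.even_or_odd' n
    · rw [binOnes_two_mul] at h
      have hd : d ≠ 0 := by
        rintro rfl
        simp [binOnes_zero] at h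
      obtain ⟨k, hk⟩ := ih d (by omega) h
      exact ⟨k + 1, by rw [hk, pow_succ']⟩
    · rw [binOnes_two_mul_add_one] at h
      rcases Nat.eq_zero_or_pos d with rfl | hd
      · exact ⟨0, rfl⟩
      · have := binOnes_pos hd
        omega

theorem binOnes_add_one_le (n : ℕ) : binOnes (n + 1) ≤ binOnes n + 1 := by
  induction n using Nat.strong_induction_on with
  | _ n ih =>
    obtain ⟨d, rfl | rfl⟩ := Nat.even_or_odd' n
    · rw [binOnes_two_mul, binOnes_two_mul_add_one]
    · rw [show 2 * d + 1 + 1 = 2 * (d + 1) by ring, binOnes_two_mul, binOnes_two_mul_add_one]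
      have := ih d (by omega)
      omega

theorem binOnes_add_two_pow_le (n k : ℕ) : binOnes (n + 2 ^ k) ≤ binOnes n + 1 := by
  have hlt : n % 2 ^ k < 2 ^ k := Nat.mod_lt _ (by positivity)
  have h1 := binOnes_add_two_pow_mul (n / 2 ^ k) hlt
  have h2 := binOnes_add_two_pow_mul (n / 2 ^ k + 1) hlt
  have h3 := binOnes_add_one_le (n / 2 ^ k)
  rw [mul_add_one, ← add_assoc] at h2
  rw [Nat.mod_add_div] at h1 h2
  omega

theorem le_binOnes_add_of_dvd_add_one {k a b : ℕ} (h : 2 ^ k ∣ a + b + 1) :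
    k ≤ binOnes a + binOnes b := by
  induction k generalizing a b with
  | zero => simp
  | succ k ih =>
    rw [pow_succ'] at h
    have h2 : 2 ∣ a + b + 1 := dvd_of_mul_right_dvd h
    obtain ⟨d, rfl | rfl⟩ := Nat.even_or_odd' a <;> obtain ⟨e, rfl | rfl⟩ := Nat.even_or_odd' b
    · omega
    · rw [show 2 * d + (2 * e + 1) + 1 = 2 * (d + e + 1) by ring] at h
      have := ih (Nat.dvd_of_mul_dvd_mul_left two_pos h)
      rw [binOnes_two_mul, binOnes_two_mul_add_one]
      omega
    · rw [show 2 * d + 1 + 2 * e + 1 = 2 * (d + e + 1) by ring] at h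
      have := ih (Nat.dvd_of_mul_dvd_mul_left two_pos h)
      rw [binOnes_two_mul, binOnes_two_mul_add_one]
      omega
    · omega

/-- If a sum of two numbers, one of them odd, is divisible by `2 ^ k`, then carrying forces the
summands to have at least `k + 1` ones in total. -/
theorem lt_binOnes_add_of_dvd_add {k a b : ℕ} (ha : Odd a) (h : 2 ^ k ∣ a + b) :
    k < binOnes a + binOnes b := by
  obtain ⟨d, rfl⟩ := ha
  have := le_binOnes_add_of_dvd_add_one (a := 2 * d) (b := b) (by convert h using 1; ring)
  rw [binOnes_two_mul] at this
  rw [binOnes_two_mul_add_one]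
  omega

theorem binOnes_mul_odd_ne_one {v m : ℕ} (hm : Odd m) (h : 1 < m) : binOnes (v * m) ≠ 1 := by
  intro h1
  obtain ⟨k, hk⟩ := exists_eq_two_pow_of_binOnes_eq_one h1
  have hcop : Nat.Coprime m (2 ^ k) := hm.coprime_two_right.pow_right k
  have := hcop.eq_one_of_dvd (hk ▸ Dvd.intro_left v rfl)
  omega

theorem two_le_binOnes_mul_odd {v m : ℕ} (hv : 0 < v) (hm : Odd m) (h : 1 < m) :
    2 ≤ binOnes (v * m) := by
  have h1 := binOnes_mul_odd_ne_one (v := v) hm h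
  have h2 := binOnes_pos (n := v * m) (by positivity)
  omega

/-! ### The odd part of a triangular number -/

/-- `n (n + 1) / 2 ^ c` for `n = 2 ^ c * z`. -/
def reducedPronic (c z : ℕ) : ℕ := z * (1 + 2 ^ c * z)

theorem binOnes_triangular_two_pow_mul (c z : ℕ) :
    binOnes (triangular (2 ^ c * z)) = binOnes (reducedPronic c z) := by
  have h : 2 * triangular (2 ^ c * z) = 2 ^ c * reducedPronic c z := by
    rw [triangular, Nat.mul_div_cancel' (Nat.even_mul_succ_self _).two_dvd, reducedPronic]
    ring
  rw [← binOnes_two_mul, h, binOnes_two_pow_mul]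

theorem reducedPronic_add (c u L v : ℕ) :
    reducedPronic c (u + 2 ^ L * v) =
      reducedPronic c u + 2 ^ L * (v * (1 + 2 ^ (c + 1) * u + 2 ^ (c + L) * v)) := by
  simp only [reducedPronic]
  ring

theorem reducedPronic_lower_digits (c u L v : ℕ) (hv : 0 < v) :
    binOnes (reducedPronic c u % 2 ^ L) < binOnes (reducedPronic c (u + 2 ^ L * v)) := by
  have h : reducedPronic c (u + 2 ^ L * v) = reducedPronic c u % 2 ^ L +
      2 ^ L * (reducedPronic c u / 2 ^ L +
        v * (1 + 2 ^ (c + 1) * u + 2 ^ (c + L) * v)) := by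
    rw [reducedPronic_add, Nat.mul_add (2 ^ L) (reducedPronic c u / 2 ^ L), ← add_assoc,
      Nat.mod_add_div]
  rw [h, binOnes_add_two_pow_mul _ (Nat.mod_lt _ (by positivity))]
  have := binOnes_pos (n := reducedPronic c u / 2 ^ L +
    v * (1 + 2 ^ (c + 1) * u + 2 ^ (c + L) * v)) (by positivity)
  omega

theorem reducedPronic_large_gap (c u L v : ℕ) (hv : 0 < v) (hL : 0 < L)
    (h : reducedPronic c u < 2 ^ L) :
    binOnes (reducedPronic c u) + 2 ≤ binOnes (reducedPronic c (u + 2 ^ L * v)) := by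
  rw [reducedPronic_add, binOnes_add_two_pow_mul _ h]
  have hodd : Odd (1 + 2 ^ (c + 1) * u + 2 ^ (c + L) * v) := by
    obtain ⟨l, rfl⟩ : ∃ l, L = l + 1 := ⟨L - 1, by omega⟩
    exact ⟨2 ^ c * u + 2 ^ (c + l) * v, by ring⟩
  have := two_le_binOnes_mul_odd hv hodd (by
    have : 0 < 2 ^ (c + L) * v := by positivity
    omega)
  omega

/-! ### Exhaustive search over binary expansions -/

/-- Search over the numbers `u + 2 ^ L * v` with `binOnes v = r`, extending `u` digit by digit:
returns `true` only if `reducedPronic c` has at least four ones at all of them. -/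
def fourOnesSearch (c : ℕ) : ℕ → ℕ → ℕ → ℕ → Bool
  | 0, _, _, _ => false
  | fuel + 1, u, L, r =>
    if r = 0 then decide (4 ≤ binOnes (reducedPronic c u))
    else
      decide (3 ≤ binOnes (reducedPronic c u % 2 ^ L)) ||
      (decide (reducedPronic c u < 2 ^ L) && decide (2 ≤ binOnes (reducedPronic c u))) ||
      (fourOnesSearch c fuel u (L + 1) r && fourOnesSearch c fuel (u + 2 ^ L) (L + 1) (r - 1))

theorem four_le_of_fourOnesSearch {c fuel u L r v : ℕ} (hL : 0 < L)
    (h : fourOnesSearch c fuel u L r = true) (hv : binOnes v = r) :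
    4 ≤ binOnes (reducedPronic c (u + 2 ^ L * v)) := by
  induction fuel generalizing u L r v with
  | zero => simp [fourOnesSearch] at h
  | succ fuel ih =>
    rw [fourOnesSearch] at h
    rcases Nat.eq_zero_or_pos v with rfl | hpos
    · rw [binOnes_zero] at hv
      simpa [← hv] using h
    have hr : r ≠ 0 := by
      have := binOnes_pos hpos
      omega
    simp only [hr, if_false, Bool.or_eq_true, Bool.and_eq_true, decide_eq_true_eq] at h
    rcases h with (h | ⟨h1, h2⟩) | ⟨h0, h1⟩
    · have := reducedPronic_lower_digits c u L v hpos
      omega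
    · have := reducedPronic_large_gap c u L v hpos hL h1
      omega
    · obtain ⟨d, rfl | rfl⟩ := Nat.even_or_odd' v
      · rw [binOnes_two_mul] at hv
        have := ih (by omega) h0 hv
        rwa [pow_succ, mul_assoc] at this
      · rw [binOnes_two_mul_add_one] at hv
        have := ih (v := d) (by omega) h1 (by omega)
        rwa [show u + 2 ^ L + 2 ^ (L + 1) * d = u + 2 ^ L * (2 * d + 1) by ring] at this

theorem fourOnesSearch_of_le_five {c : ℕ} (h1 : 1 ≤ c) (h5 : c ≤ 5) :
    fourOnesSearch c 25 1 1 5 = true := by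
  interval_cases c <;> decide +kernel

theorem fourOnesSearch_zero {L : ℕ} (h1 : 1 ≤ L) (h9 : L ≤ 9) :
    fourOnesSearch 0 25 (1 + 2 ^ L) (L + 1) 4 = true := by
  interval_cases L <;> decide +kernel

/-! ### Bounding the parameters -/

/-- The case where `1` is the only one among the `c` lowest binary digits of `z`. -/
theorem le_five_of_one_add_two_pow_mul {c v : ℕ} (hc : 1 ≤ c) (hv : binOnes v = 5)
    (hS : binOnes (v + (1 + 2 ^ c * v) ^ 2) ≤ 2) : c ≤ 5 := by
  obtain ⟨c, rfl⟩ : ∃ d, c = d + 1 := ⟨c - 1, by omega⟩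
  have hpos : 0 < v := by
    rcases Nat.eq_zero_or_pos v with rfl | h
    · simp [binOnes_zero] at hv
    · exact h
  set e := (v + 1) % 2 ^ (c + 2) with he
  set y := (v + 1) / 2 ^ (c + 2) with hy
  have hlt : e < 2 ^ (c + 2) := Nat.mod_lt _ (by positivity)
  have hey : v + 1 = e + 2 ^ (c + 2) * y := (Nat.mod_add_div _ _).symm
  have hsum : v + (1 + 2 ^ (c + 1) * v) ^ 2 = e + 2 ^ (c + 2) * (y + v + 2 ^ c * v ^ 2) := by
    rw [show v + (1 + 2 ^ (c + 1) * v) ^ 2 =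
      (v + 1) + 2 ^ (c + 2) * (v + 2 ^ c * v ^ 2) by ring, hey]
    ring
  rw [hsum, binOnes_add_two_pow_mul _ hlt] at hS
  have hY := binOnes_pos (n := y + v + 2 ^ c * v ^ 2) (by positivity)
  rcases Nat.eq_zero_or_pos e with he0 | he0
  · have := le_binOnes_add_of_dvd_add_one (k := c + 2) (a := v) (b := 0)
      (by rw [add_zero, hey, he0, zero_add]; exact dvd_mul_right _ _)
    rw [binOnes_zero] at this
    omega
  have he1 := binOnes_pos he0
  obtain ⟨j, hj⟩ := exists_eq_two_pow_of_binOnes_eq_one (n := e) (by omega)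
  obtain ⟨q, hq⟩ := exists_eq_two_pow_of_binOnes_eq_one
    (n := y + v + 2 ^ c * v ^ 2) (by omega)
  have hv' : v = (e - 1) + 2 ^ (c + 2) * y := by omega
  rcases Nat.eq_zero_or_pos j with rfl | hj0
  · have hvy : v = 2 ^ (c + 2) * y := by
      rw [hv', hj]
      simp
    have hY1 : binOnes (y * (1 + 2 ^ (c + 2) + 2 ^ c * 2 ^ (2 * c + 4) * y)) = 1 := by
      refine Eq.trans (congrArg binOnes ?_) (binOnes_two_pow q)
      rw [← hq, hvy]
      ring
    refine absurd hY1 (binOnes_mul_odd_ne_one ?_ ?_)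
    · exact ⟨2 ^ (c + 1) + 2 ^ c * 2 ^ (2 * c + 3) * y, by ring⟩
    · have : 0 < 2 ^ (c + 2) := by positivity
      omega
  · have hcq : c ≤ q := by
      rw [← Nat.pow_le_pow_iff_right one_lt_two, ← hq]
      nlinarith [Nat.one_le_two_pow (n := c), Nat.one_le_pow 2 v hpos]
    have hdvd : 2 ^ c ∣ y + v := by
      refine (Nat.dvd_add_left (dvd_mul_right (2 ^ c) (v ^ 2))).mp ?_
      rw [hq]
      exact pow_dvd_pow 2 hcq
    have hdvd' : 2 ^ c ∣ (e - 1) + y := by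
      refine (Nat.dvd_add_left (show 2 ^ c ∣ 2 ^ (c + 2) * y from
        (pow_dvd_pow 2 (by omega)).mul_right y)).mp ?_
      convert hdvd using 1
      omega
    have hodd : Odd (e - 1) := by
      rw [hj]
      exact Nat.Even.sub_odd Nat.one_le_two_pow ((Nat.even_pow).mpr ⟨even_two, by omega⟩) odd_one
    have h1 := lt_binOnes_add_of_dvd_add hodd hdvd'
    rw [hv', binOnes_add_two_pow_mul _ (by omega)] at hv
    omega

theorem le_five_of_binOnes_reducedPronic_le {c z : ℕ} (hc : 1 ≤ c) (hodd : Odd z)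
    (hz : binOnes z = 6) (hw : binOnes (reducedPronic c z) ≤ 3) : c ≤ 5 := by
  set u := z % 2 ^ c with hu
  set v := z / 2 ^ c with hv
  have hlt : u < 2 ^ c := Nat.mod_lt _ (by positivity)
  have huv : z = u + 2 ^ c * v := (Nat.mod_add_div _ _).symm
  have huodd : Odd u := by
    rw [huv, Nat.odd_add] at hodd
    exact hodd.mpr (((Nat.even_pow).mpr ⟨even_two, by omega⟩).mul_right v)
  have hwsum : reducedPronic c z = u + 2 ^ c * (v + z ^ 2) := by
    rw [reducedPronic, show z * (1 + 2 ^ c * z) = z + 2 ^ c * z ^ 2 by ring]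
    nth_rewrite 1 [huv]
    ring
  rw [hwsum, binOnes_add_two_pow_mul _ hlt] at hw
  have hzuv := hz
  rw [huv, binOnes_add_two_pow_mul _ hlt] at hzuv
  have hS := binOnes_pos (n := v + z ^ 2) (by have := hodd.pos; positivity)
  have hupos := binOnes_pos huodd.pos
  rcases Nat.lt_or_ge (binOnes u) 2 with h1 | h2
  · obtain ⟨k, hk⟩ := exists_eq_two_pow_of_binOnes_eq_one (n := u) (by omega)
    obtain rfl : k = 0 := by
      by_contra hk0
      rw [hk] at huodd
      exact Nat.not_even_iff_odd.mpr huodd ((Nat.even_pow).mpr ⟨even_two, hk0⟩)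
    rw [pow_zero] at hk
    rw [hk] at huv hzuv hw
    rw [binOnes_one] at hzuv hw
    rw [huv] at hw
    exact le_five_of_one_add_two_pow_mul (v := v) hc (by omega) (by omega)
  · obtain ⟨r, hr⟩ := exists_eq_two_pow_of_binOnes_eq_one (n := v + z ^ 2) (by omega)
    obtain ⟨s, hs⟩ := huodd
    obtain ⟨t, ht⟩ := exists_eq_two_pow_of_binOnes_eq_one (n := s) (by
      rw [hs, binOnes_two_mul_add_one] at hw h2
      omega)
    have hu2 : binOnes (u ^ 2) ≤ 3 := by
      have h := binOnes_add_two_pow_le (1 + 2 ^ (2 * t + 2)) (t + 2)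
      have h' := binOnes_add_two_pow_le 1 (2 * t + 2)
      rw [binOnes_one] at h'
      rw [hs, ht, show (2 * 2 ^ t + 1) ^ 2 = 1 + 2 ^ (2 * t + 2) + 2 ^ (t + 2) by ring]
      omega
    have hvpos : 0 < v := by
      rcases Nat.eq_zero_or_pos v with h | h
      · rw [h, binOnes_zero] at hzuv
        omega
      · exact h
    have hcz : 2 ^ c ≤ z := by nlinarith
    have hcr : c + 1 ≤ r := by
      rw [← Nat.pow_le_pow_iff_right one_lt_two, ← hr, pow_succ]
      have : 2 ≤ z := le_trans (by simpa using Nat.pow_le_pow_right two_pos hc) hcz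
      nlinarith
    have hdvd : 2 ^ (c + 1) ∣ u ^ 2 + v := by
      have h : 2 ^ (c + 1) ∣ u ^ 2 + v + 2 ^ (c + 1) * (u * v + 2 ^ (c - 1) * v ^ 2) := by
        obtain ⟨c, rfl⟩ : ∃ d, c = d + 1 := ⟨c - 1, by omega⟩
        have hsum : u ^ 2 + v + 2 ^ (c + 1 + 1) * (u * v + 2 ^ c * v ^ 2) = v + z ^ 2 := by
          rw [show z ^ 2 = (u + 2 ^ (c + 1) * v) ^ 2 from congrArg (· ^ 2) huv]
          ring
        rw [Nat.add_sub_cancel, hsum, hr]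
        exact pow_dvd_pow 2 hcr
      exact (Nat.dvd_add_left (dvd_mul_right _ _)).mp h
    have := lt_binOnes_add_of_dvd_add (Odd.pow ⟨s, hs⟩) hdvd
    omega

theorem le_nine_of_binOnes_reducedPronic_le {L v : ℕ} (hL : 1 ≤ L) (hodd : Odd v)
    (hv : binOnes v = 5) (hw : binOnes (reducedPronic 0 (1 + 2 ^ L * v)) ≤ 3) : L ≤ 9 := by
  rcases Nat.lt_or_ge L 2 with h | h2
  · omega
  have hL4 : 2 ^ 2 ≤ 2 ^ L := Nat.pow_le_pow_right two_pos h2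
  have h2pow : reducedPronic 0 1 = 2 ^ 1 := rfl
  rw [reducedPronic_add, binOnes_add_two_pow_mul _ (by omega), h2pow, binOnes_two_pow] at hw
  have hexp : v * (1 + 2 ^ (0 + 1) * 1 + 2 ^ (0 + L) * v) = 3 * v + 2 ^ L * v ^ 2 := by
    rw [zero_add, zero_add]
    ring
  rw [hexp] at hw
  obtain ⟨d, rfl⟩ := hodd
  obtain ⟨l, rfl⟩ : ∃ l, L = l + 1 := ⟨L - 1, by omega⟩
  have hhalf : 3 * (2 * d + 1) + 2 ^ (l + 1) * (2 * d + 1) ^ 2 =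
      2 * (3 * d + 1 + 2 ^ l * (2 * d + 1) ^ 2) + 1 := by ring
  rw [hhalf, binOnes_two_mul_add_one] at hw
  have hpos := binOnes_pos (n := 3 * d + 1 + 2 ^ l * (2 * d + 1) ^ 2) (by positivity)
  obtain ⟨q, hq⟩ := exists_eq_two_pow_of_binOnes_eq_one
    (n := 3 * d + 1 + 2 ^ l * (2 * d + 1) ^ 2) (by omega)
  have hlq : l ≤ q := by
    rw [← Nat.pow_le_pow_iff_right one_lt_two, ← hq]
    nlinarith [Nat.one_le_two_pow (n := l), Nat.one_le_pow 2 (2 * d + 1) (by omega)]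
  have hdvd : 2 ^ l ∣ 3 * d + 1 := by
    refine (Nat.dvd_add_left (dvd_mul_right (2 ^ l) ((2 * d + 1) ^ 2))).mp ?_
    rw [hq]
    exact pow_dvd_pow 2 hlq
  have := le_binOnes_add_of_dvd_add_one (k := l) (a := d) (b := 2 * d)
    (by convert hdvd using 1; ring)
  rw [binOnes_two_mul] at this
  rw [binOnes_two_mul_add_one] at hv
  omega

theorem stmt18 (n : ℕ) (hn : binOnes n = 6) : 4 ≤ binOnes (triangular n) := by
  have hn0 : n ≠ 0 := by
    rintro rfl
    simp [binOnes_zero] at hn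
  obtain ⟨c, z, hz, rfl⟩ := Nat.exists_eq_two_pow_mul_odd hn0
  rw [binOnes_two_pow_mul] at hn
  rw [binOnes_triangular_two_pow_mul]
  by_contra! hw
  obtain ⟨d, hd⟩ := hz
  have hd5 : binOnes d = 5 := by
    rw [hd, binOnes_two_mul_add_one] at hn
    omega
  rcases Nat.eq_zero_or_pos c with rfl | hc
  · have hd0 : d ≠ 0 := by
      rintro rfl
      simp [binOnes_zero] at hd5
    obtain ⟨l, v, hv, rfl⟩ := Nat.exists_eq_two_pow_mul_odd hd0
    rw [binOnes_two_pow_mul] at hd5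
    have hz' : z = 1 + 2 ^ (l + 1) * v := by rw [hd]; ring
    have h9 := le_nine_of_binOnes_reducedPronic_le (L := l + 1) (by omega) hv hd5
      (by rw [← hz']; omega)
    obtain ⟨e, rfl⟩ := hv
    rw [binOnes_two_mul_add_one] at hd5
    have := four_le_of_fourOnesSearch (v := e) (by omega)
      (fourOnesSearch_zero (by omega) h9) (by omega)
    rw [show 1 + 2 ^ (l + 1) + 2 ^ (l + 1 + 1) * e = z by rw [hz']; ring] at this
    omega
  · have h5 := le_five_of_binOnes_reducedPronic_le hc ⟨d, hd⟩ hn (by omega)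
    have := four_le_of_fourOnesSearch one_pos (fourOnesSearch_of_le_five hc h5) hd5
    rw [show 1 + 2 ^ 1 * d = z by rw [hd]; ring] at this
    omega
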